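/- arXiv:2402.02083 — 3 statements merged into one kernel-verified Lean document; each statement's English description precedes it below -/
import Mathlib

section
/- Let G be a finite simple graph containing a vertex v of degree 10 with distinct neighbors u_1, …, u_10 such that u_i u_{i+1} ∈ E(G) for i = 1, …, 9 and u_10 u_1 ∈ E(G) (so {v, u_1, …, u_10} is a 10-wheel with hub v). Suppose d(u_1) = d(u_3) = d(u_5) = d(u_7) = 3, d(u_9) ≤ 5, and {u_1, u_3, u_5, u_7, u_9} is an independent set in G. Then there exists a set B of at most 8 edges of G such that γ_i(G − B) > γ_i(G); that is, b_i(G) ≤ 8. -/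
open scoped BigOperators

/-- A set of vertices is an independent dominating set: it is independent
(no two of its vertices are adjacent) and dominating (every vertex is in it
or adjacent to a vertex in it). -/
def SimpleGraph.IsIndepDomSet {V : Type*} (G : SimpleGraph V) (S : Set V) : Prop :=
  (∀ u ∈ S, ∀ w ∈ S, ¬ G.Adj u w) ∧ ∀ x, x ∈ S ∨ ∃ u ∈ S, G.Adj u x

/-- The independent domination number: the minimum cardinality of an
independent dominating set. -/
noncomputable def SimpleGraph.indepDomNum {V : Type*} (G : SimpleGraph V) : ℕ :=
  sInf {n | ∃ S : Set V, G.IsIndepDomSet S ∧ S.ncard = n}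

open scoped Classical in
/-- An independent set extends to an independent dominating set using only vertices
that it does not dominate. -/
theorem SimpleGraph.exists_isIndepDomSet_card_le {V : Type*} (G : SimpleGraph V) (T U : Finset V)
    (hT : ∀ x ∈ T, ∀ y ∈ T, ¬ G.Adj x y)
    (hU : ∀ x, x ∈ T ∨ (∃ t ∈ T, G.Adj t x) ∨ x ∈ U) :
    ∃ S : Finset V, G.IsIndepDomSet (S : Set V) ∧ S.card ≤ T.card + U.card := by
  let F : Finset (Finset V) := (T ∪ U).powerset.filter
    fun A ↦ T ⊆ A ∧ ∀ x ∈ A, ∀ y ∈ A, ¬ G.Adj x y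
  have hF : F.Nonempty :=
    ⟨T, Finset.mem_filter.2 ⟨Finset.mem_powerset.2 Finset.subset_union_left, subset_rfl, hT⟩⟩
  obtain ⟨A, hAF, hmax⟩ := F.exists_max_image Finset.card hF
  obtain ⟨hA, hTA, hind⟩ := Finset.mem_filter.1 hAF
  rw [Finset.mem_powerset] at hA
  refine ⟨A, ⟨by simpa using hind, fun x ↦ ?_⟩, (Finset.card_le_card hA).trans
    (Finset.card_union_le T U)⟩
  by_contra! hx
  obtain ⟨hxA, hxd⟩ := hx
  simp only [Finset.mem_coe] at hxA hxd
  have hxU : x ∈ U := by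
    rcases hU x with h | ⟨t, ht, h⟩ | h
    · exact absurd (hTA h) hxA
    · exact absurd h (hxd t (hTA ht))
    · exact h
  have hmem : insert x A ∈ F := by
    refine Finset.mem_filter.2 ⟨Finset.mem_powerset.2 (Finset.insert_subset
      (Finset.mem_union_right T hxU) hA), hTA.trans (Finset.subset_insert x A), ?_⟩
    intro y hy z hz hyz
    rcases Finset.mem_insert.1 hy with rfl | hyA <;> rcases Finset.mem_insert.1 hz with rfl | hzA
    · exact G.irrefl hyz
    · exact hxd z hzA hyz.symm
    · exact hxd y hyA hyz
    · exact hind y hyA z hzA hyz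
  have := hmax _ hmem
  rw [Finset.card_insert_of_notMem hxA] at this
  omega

theorem SimpleGraph.IsIndepDomSet.indepDomNum_le {V : Type*} {G : SimpleGraph V} {S : Finset V}
    (hS : G.IsIndepDomSet (S : Set V)) : G.indepDomNum ≤ S.card :=
  Nat.sInf_le ⟨S, hS, Set.ncard_coe_finset S⟩

theorem SimpleGraph.indepDomNum_le_card_add_card {V : Type*} (G : SimpleGraph V) (T U : Finset V)
    (hT : ∀ x ∈ T, ∀ y ∈ T, ¬ G.Adj x y)
    (hU : ∀ x, x ∈ T ∨ (∃ t ∈ T, G.Adj t x) ∨ x ∈ U) :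
    G.indepDomNum ≤ T.card + U.card := by
  obtain ⟨S, hS, hcard⟩ := G.exists_isIndepDomSet_card_le T U hT hU
  exact hS.indepDomNum_le.trans hcard

theorem SimpleGraph.exists_isIndepDomSet_card_eq {V : Type*} [Fintype V] (G : SimpleGraph V) :
    ∃ S : Finset V, G.IsIndepDomSet (S : Set V) ∧ S.card = G.indepDomNum := by
  classical
  obtain ⟨A, hA, -⟩ := G.exists_isIndepDomSet_card_le ∅ Finset.univ (by simp) (by simp)
  obtain ⟨S, hS, hcard⟩ := Nat.sInf_mem
    (s := {n | ∃ S : Set V, G.IsIndepDomSet S ∧ S.ncard = n}) ⟨_, A, hA, rfl⟩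
  refine ⟨S.toFinset, by simpa using hS, ?_⟩
  rw [← Set.ncard_eq_toFinset_card', hcard]
  rfl

open scoped Classical in
/-- If removing `R` from an independent dominating set `S` of `G - B` destroys all edges of `B`
inside `S` and leaves undominated fewer than `|R|` vertices, then `γ_i(G) < |S|`. -/
theorem SimpleGraph.indepDomNum_lt_of_sdiff {V : Type*} (G : SimpleGraph V) (B : Set (Sym2 V))
    (S R U : Finset V) (hS : (G.deleteEdges B).IsIndepDomSet (S : Set V)) (hRS : R ⊆ S)
    (hcard : U.card < R.card)
    (hB : ∀ x ∈ S, x ∉ R → ∀ y ∈ S, y ∉ R → s(x, y) ∉ B)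
    (hR : ∀ r ∈ R, r ∈ U ∨ ∃ t ∈ S, t ∉ R ∧ G.Adj t r)
    (hN : ∀ r ∈ R, ∀ x, (G.deleteEdges B).Adj r x → x ∈ U ∨ ∃ t ∈ S, t ∉ R ∧ G.Adj t x) :
    G.indepDomNum < S.card := by
  have key := G.indepDomNum_le_card_add_card (S \ R) U
    (fun x hx y hy hxy ↦ by
      rw [Finset.mem_sdiff] at hx hy
      exact hS.1 x (by simpa using hx.1) y (by simpa using hy.1)
        (SimpleGraph.deleteEdges_adj.2 ⟨hxy, hB x hx.1 hx.2 y hy.1 hy.2⟩))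
    (fun x ↦ by
      have hdom : (x ∈ U ∨ ∃ t ∈ S, t ∉ R ∧ G.Adj t x) →
          x ∈ S \ R ∨ (∃ t ∈ S \ R, G.Adj t x) ∨ x ∈ U := by
        rintro (h | ⟨t, ht, htR, h⟩)
        · exact Or.inr (Or.inr h)
        · exact Or.inr (Or.inl ⟨t, Finset.mem_sdiff.2 ⟨ht, htR⟩, h⟩)
      rcases hS.2 x with h | ⟨t, ht, h⟩
      · by_cases hxR : x ∈ R
        · exact hdom (hR x hxR)
        · exact Or.inl (Finset.mem_sdiff.2 ⟨by simpa using h, hxR⟩)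
      · by_cases htR : t ∈ R
        · exact hdom (hN t htR x h)
        · exact hdom (Or.inr ⟨t, by simpa using ht, htR, (SimpleGraph.deleteEdges_adj.1 h).1⟩))
  rw [Finset.card_sdiff_of_subset hRS] at key
  have := Finset.card_le_card hRS
  omega

/-- A neighborhood of size three is determined by three distinct neighbors. -/
theorem SimpleGraph.adj_iff_of_ncard_neighborSet_eq_three {V : Type*} [Finite V]
    (G : SimpleGraph V) {w a b c : V} (hw : (G.neighborSet w).ncard = 3)
    (ha : G.Adj w a) (hb : G.Adj w b) (hc : G.Adj w c) (hab : a ≠ b) (hac : a ≠ c) (hbc : b ≠ c)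
    (x : V) : G.Adj w x ↔ x = a ∨ x = b ∨ x = c := by
  have hsub : ({a, b, c} : Set V) ⊆ G.neighborSet w := by
    rintro y (rfl | rfl | rfl) <;> assumption
  have heq := Set.eq_of_subset_of_ncard_le hsub
    (by rw [hw, Set.ncard_eq_three.2 ⟨a, b, c, hab, hac, hbc, rfl⟩])
  rw [← SimpleGraph.mem_neighborSet, ← heq]
  simp

theorem stmt3 {V : Type*} [Fintype V]
    (G : SimpleGraph V) (v : V) (u : Fin 10 → V)
    (hinj : Function.Injective u)
    (hdeg : (G.neighborSet v).ncard = 10)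
    (hnbr : ∀ i, G.Adj v (u i))
    (hcyc : ∀ i : Fin 10, i.val < 9 → G.Adj (u i) (u (i + 1)))
    (hlast : G.Adj (u 9) (u 0))
    (hd1 : (G.neighborSet (u 0)).ncard = 3)
    (hd3 : (G.neighborSet (u 2)).ncard = 3)
    (hd5 : (G.neighborSet (u 4)).ncard = 3)
    (hd7 : (G.neighborSet (u 6)).ncard = 3)
    (hd9 : (G.neighborSet (u 8)).ncard ≤ 5)
    (hind : ∀ i ∈ ({0, 2, 4, 6, 8} : Finset (Fin 10)),
      ∀ j ∈ ({0, 2, 4, 6, 8} : Finset (Fin 10)), ¬ G.Adj (u i) (u j)) :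
    ∃ B : Finset (Sym2 V), ↑B ⊆ G.edgeSet ∧ B.card ≤ 8 ∧
      G.indepDomNum < (G.deleteEdges ↑B).indepDomNum := by
  classical
  have hu : ∀ i j, u i = u j ↔ i = j := fun i j ↦ hinj.eq_iff
  have hvu : ∀ i, v ≠ u i := fun i ↦ (hnbr i).ne
  have hv : ∀ x, G.Adj v x → ∃ i, x = u i := by
    have hsub : Set.range u ⊆ G.neighborSet v := by
      rintro _ ⟨i, rfl⟩
      exact hnbr i
    have heq := Set.eq_of_subset_of_ncard_le hsub (by
      rw [hdeg, ← Set.image_univ, Set.ncard_image_of_injective _ hinj, Set.ncard_univ,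
        Nat.card_eq_fintype_card, Fintype.card_fin])
    intro x hx
    obtain ⟨i, hi⟩ := heq.symm.subset hx
    exact ⟨i, hi.symm⟩
  have h01 : G.Adj (u 0) (u 1) := hcyc 0 (by decide)
  have h12 : G.Adj (u 1) (u 2) := hcyc 1 (by decide)
  have h23 : G.Adj (u 2) (u 3) := hcyc 2 (by decide)
  have h34 : G.Adj (u 3) (u 4) := hcyc 3 (by decide)
  have h45 : G.Adj (u 4) (u 5) := hcyc 4 (by decide)
  have h56 : G.Adj (u 5) (u 6) := hcyc 5 (by decide)
  have h67 : G.Adj (u 6) (u 7) := hcyc 6 (by decide)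
  have h78 : G.Adj (u 7) (u 8) := hcyc 7 (by decide)
  have h89 : G.Adj (u 8) (u 9) := hcyc 8 (by decide)
  have N0 := G.adj_iff_of_ncard_neighborSet_eq_three hd1 (hnbr 0).symm h01 hlast.symm
    (hvu 1) (hvu 9) (by simp [hu])
  have N2 := G.adj_iff_of_ncard_neighborSet_eq_three hd3 (hnbr 2).symm h12.symm h23
    (hvu 1) (hvu 3) (by simp [hu])
  have N4 := G.adj_iff_of_ncard_neighborSet_eq_three hd5 (hnbr 4).symm h34.symm h45
    (hvu 3) (hvu 5) (by simp [hu])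
  have N6 := G.adj_iff_of_ncard_neighborSet_eq_three hd7 (hnbr 6).symm h56.symm h67
    (hvu 5) (hvu 7) (by simp [hu])
  obtain ⟨W, hW, N8⟩ : ∃ W : Finset V, W.card ≤ 2 ∧
      ∀ x, G.Adj (u 8) x → x = v ∨ x = u 7 ∨ x = u 9 ∨ x ∈ W := by
    have hsub : ({v, u 7, u 9} : Finset V) ⊆ (G.neighborSet (u 8)).toFinset := by
      intro x hx
      simp only [Finset.mem_insert, Finset.mem_singleton] at hx
      rcases hx with rfl | rfl | rfl
      · simpa using (hnbr 8).symm
      · simpa using h78.symm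
      · simpa using h89
    refine ⟨(G.neighborSet (u 8)).toFinset \ {v, u 7, u 9}, ?_, fun x hx ↦ ?_⟩
    · rw [Finset.card_sdiff_of_subset hsub, ← Set.ncard_eq_toFinset_card',
        Finset.card_eq_three.2 ⟨v, u 7, u 9, hvu 7, hvu 9, by simp [hu], rfl⟩]
      omega
    · by_cases h : x ∈ ({v, u 7, u 9} : Finset V)
      · simp only [Finset.mem_insert, Finset.mem_singleton] at h
        tauto
      · exact Or.inr (Or.inr (Or.inr (Finset.mem_sdiff.2 ⟨by simpa using hx, h⟩)))
  obtain ⟨B, hBcard, hB⟩ : ∃ B : Finset (Sym2 V), B.card ≤ 8 ∧ ∀ e, e ∈ (B : Set (Sym2 V)) ↔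
      e = s(u 0, v) ∨ e = s(u 0, u 1) ∨ e = s(u 0, u 9) ∨ e = s(u 2, v) ∨ e = s(u 2, u 1) ∨
      e = s(u 2, u 3) ∨ e = s(u 4, u 5) ∨ e = s(u 6, u 7) :=
    ⟨{s(u 0, v), s(u 0, u 1), s(u 0, u 9), s(u 2, v), s(u 2, u 1), s(u 2, u 3), s(u 4, u 5),
      s(u 6, u 7)}, (Finset.card_insert_le _ _).trans (Nat.succ_le_succ
        ((Finset.card_insert_le _ _).trans (Nat.succ_le_succ Finset.card_le_six))),
      fun e ↦ by simp⟩
  refine ⟨B, ?_, hBcard, ?_⟩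
  · intro e he
    rcases (hB e).1 he with rfl | rfl | rfl | rfl | rfl | rfl | rfl | rfl
    exacts [(hnbr 0).symm, h01, hlast.symm, (hnbr 2).symm, h12.symm, h23, h45, h67]
  obtain ⟨S, hS, hScard⟩ := (G.deleteEdges (B : Set (Sym2 V))).exists_isIndepDomSet_card_eq
  rw [← hScard]
  have M0 : ∀ x, ¬ (G.deleteEdges (B : Set (Sym2 V))).Adj (u 0) x := by
    intro x hx
    rw [SimpleGraph.deleteEdges_adj, N0, hB] at hx
    rcases hx with ⟨rfl | rfl | rfl, h⟩ <;> exact h (by simp only [true_or, or_true])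
  have M2 : ∀ x, ¬ (G.deleteEdges (B : Set (Sym2 V))).Adj (u 2) x := by
    intro x hx
    rw [SimpleGraph.deleteEdges_adj, N2, hB] at hx
    rcases hx with ⟨rfl | rfl | rfl, h⟩ <;> exact h (by simp only [true_or, or_true])
  have M4 : ∀ x, (G.deleteEdges (B : Set (Sym2 V))).Adj (u 4) x → x = v ∨ x = u 3 := by
    intro x hx
    rw [SimpleGraph.deleteEdges_adj, N4, hB] at hx
    rcases hx with ⟨rfl | rfl | rfl, h⟩
    exacts [Or.inl rfl, Or.inr rfl, (h (by simp only [true_or, or_true])).elim]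
  have M6 : ∀ x, (G.deleteEdges (B : Set (Sym2 V))).Adj (u 6) x → x = v ∨ x = u 5 := by
    intro x hx
    rw [SimpleGraph.deleteEdges_adj, N6, hB] at hx
    rcases hx with ⟨rfl | rfl | rfl, h⟩
    exacts [Or.inl rfl, Or.inr rfl, (h (by simp only [or_true])).elim]
  have hdom : ∀ x, x ∈ S ∨ ∃ t ∈ S, (G.deleteEdges (B : Set (Sym2 V))).Adj x t := by
    intro x
    rcases hS.2 x with h | ⟨t, ht, h⟩
    exacts [Or.inl h, Or.inr ⟨t, ht, h.symm⟩]
  have hindS : ∀ x ∈ S, ∀ y ∈ S, G.Adj x y → s(x, y) ∈ (B : Set (Sym2 V)) := by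
    intro x hx y hy hxy
    by_contra h
    exact hS.1 x hx y hy (SimpleGraph.deleteEdges_adj.2 ⟨hxy, h⟩)
  have s0 : u 0 ∈ S := (hdom (u 0)).resolve_right fun ⟨t, _, h⟩ ↦ M0 t h
  have s2 : u 2 ∈ S := (hdom (u 2)).resolve_right fun ⟨t, _, h⟩ ↦ M2 t h
  have s4 : v ∉ S → u 3 ∉ S → u 4 ∈ S := fun hv h3 ↦ (hdom (u 4)).resolve_right
    fun ⟨t, ht, h⟩ ↦ by rcases M4 t h with rfl | rfl <;> contradiction
  have s6 : v ∉ S → u 5 ∉ S → u 6 ∈ S := fun hv h5 ↦ (hdom (u 6)).resolve_right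
    fun ⟨t, ht, h⟩ ↦ by rcases M6 t h with rfl | rfl <;> contradiction
  have hvS : ∀ i, i ≠ 0 → i ≠ 2 → v ∈ S → u i ∉ S := by
    intro i hi0 hi2 h h'
    have := (hB _).1 (hindS _ h _ h' (hnbr i))
    simp [hu, hvu, Ne.symm (hvu _), hi0, hi2] at this
  have s34 : u 3 ∈ S → u 4 ∉ S := by
    intro h h'
    have := (hB _).1 (hindS _ h _ h' h34)
    simp [hu, Ne.symm (hvu _)] at this
  have s56 : u 5 ∈ S → u 6 ∉ S := by
    intro h h'
    have := (hB _).1 (hindS _ h _ h' h56)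
    simp [hu, Ne.symm (hvu _)] at this
  have hBS : ∀ R : Finset V, (v ∉ S ∨ u 0 ∈ R ∧ u 2 ∈ R) →
      (u 1 ∉ S ∧ u 9 ∉ S ∨ u 0 ∈ R) → (u 1 ∉ S ∧ u 3 ∉ S ∨ u 2 ∈ R) →
      (u 5 ∉ S ∨ u 4 ∉ S ∨ u 4 ∈ R) → (u 7 ∉ S ∨ u 6 ∉ S ∨ u 6 ∈ R) →
      ∀ x ∈ S, x ∉ R → ∀ y ∈ S, y ∉ R → s(x, y) ∉ (B : Set (Sym2 V)) := by
    intro R h1 h2 h3 h4 h5 x hx hxR y hy hyR hxy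
    rw [hB] at hxy
    simp only [Sym2.eq_iff] at hxy
    rcases hxy with (⟨rfl, rfl⟩ | ⟨rfl, rfl⟩) | (⟨rfl, rfl⟩ | ⟨rfl, rfl⟩) | (⟨rfl, rfl⟩ | ⟨rfl, rfl⟩) |
      (⟨rfl, rfl⟩ | ⟨rfl, rfl⟩) | (⟨rfl, rfl⟩ | ⟨rfl, rfl⟩) | (⟨rfl, rfl⟩ | ⟨rfl, rfl⟩) |
      (⟨rfl, rfl⟩ | ⟨rfl, rfl⟩) | (⟨rfl, rfl⟩ | ⟨rfl, rfl⟩) <;>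
    clear * - h1 h2 h3 h4 h5 hx hy hxR hyR <;> simp_all
  have hE : ∀ i, i ∉ ({0, 2, 4, 6} : Finset (Fin 10)) →
      u i ∉ ({u 0, u 2, u 4, u 6} : Finset V) := by
    intro i hi
    simpa [hu] using hi
  have hD : ∀ R ⊆ ({u 0, u 2, u 4, u 6} : Finset V), ∀ i, i ∉ ({0, 2, 4, 6} : Finset (Fin 10)) →
      u i ∈ S → ∀ x, G.Adj (u i) x → ∃ t ∈ S, t ∉ R ∧ G.Adj t x :=
    fun R hR i hi hiS x hx ↦ ⟨u i, hiS, fun h ↦ hE i hi (hR h), hx⟩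
  by_cases hvmem : v ∈ S
  · have t4 : u 4 ∉ S := hvS 4 (by decide) (by decide) hvmem
    have t6 : u 6 ∉ S := hvS 6 (by decide) (by decide) hvmem
    have hvR : v ∉ ({u 0, u 2} : Finset V) := by simp [hvu]
    refine G.indepDomNum_lt_of_sdiff B S {u 0, u 2} ∅ hS (by simp [Finset.insert_subset_iff, s0, s2])
      (by simp) (hBS _ (by simp) (by simp) (by simp) (by simp [t4]) (by simp [t6]))
      (fun r hr ↦ Or.inr ⟨v, hvmem, hvR, ?_⟩) (fun r hr x hx ↦ ?_) <;>
    simp only [Finset.mem_insert, Finset.mem_singleton] at hr <;> rcases hr with rfl | rfl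
    exacts [hnbr 0, hnbr 2, absurd hx (M0 x), absurd hx (M2 x)]
  by_cases h45S : u 4 ∈ S ∧ u 5 ∈ S
  · obtain ⟨m4, m5⟩ := h45S
    have t6 := s56 m5
    by_cases h19 : u 1 ∈ S ∨ u 9 ∈ S
    · have D := hD {u 0, u 2, u 4} (by simp [Finset.insert_subset_iff])
      refine G.indepDomNum_lt_of_sdiff B S {u 0, u 2, u 4} {u 2, u 3} hS
        (by simp [Finset.insert_subset_iff, s0, s2, m4])
        (Finset.card_le_two.trans_lt (by simp [hu]))
        (hBS _ (by simp) (by simp) (by simp) (by simp) (by simp [t6]))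
        (fun r hr ↦ ?_) (fun r hr x hx ↦ ?_) <;>
      simp only [Finset.mem_insert, Finset.mem_singleton] at hr <;> rcases hr with rfl | rfl | rfl
      · exact Or.inr (h19.elim (fun h ↦ D 1 (by decide) h _ h01.symm)
          (fun h ↦ D 9 (by decide) h _ hlast))
      · simp
      · exact Or.inr (D 5 (by decide) m5 _ h45.symm)
      · exact absurd hx (M0 x)
      · exact absurd hx (M2 x)
      · rcases M4 x hx with rfl | rfl
        · exact Or.inr (D 5 (by decide) m5 _ (hnbr 5).symm)
        · simp
    · have D := hD {u 4} (by simp)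
      have t3 : u 3 ∉ S := fun h ↦ s34 h m4
      rw [not_or] at h19
      refine G.indepDomNum_lt_of_sdiff B S {u 4} ∅ hS (by simpa using m4) (by simp)
        (hBS _ (by simp [hvmem]) (Or.inl h19) (Or.inl ⟨h19.1, t3⟩) (by simp) (by simp [t6]))
        (fun r hr ↦ ?_) (fun r hr x hx ↦ ?_) <;>
      rw [Finset.mem_singleton] at hr <;> subst hr
      · exact Or.inr (D 5 (by decide) m5 _ h45.symm)
      · rcases M4 x hx with rfl | rfl
        · exact Or.inr (D 5 (by decide) m5 _ (hnbr 5).symm)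
        · exact Or.inr ⟨u 2, s2, by simp [hu], h23⟩
  by_cases h67S : u 6 ∈ S ∧ u 7 ∈ S
  · obtain ⟨m6, m7⟩ := h67S
    have t5 : u 5 ∉ S := fun h ↦ s56 h m6
    have D := hD {u 0, u 2, u 6} (by simp [Finset.insert_subset_iff])
    by_cases h19 : u 1 ∈ S ∨ u 9 ∈ S
    · refine G.indepDomNum_lt_of_sdiff B S {u 0, u 2, u 6} {u 2, u 5} hS
        (by simp [Finset.insert_subset_iff, s0, s2, m6])
        (Finset.card_le_two.trans_lt (by simp [hu]))
        (hBS _ (by simp) (by simp) (by simp) (by simp [t5]) (by simp))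
        (fun r hr ↦ ?_) (fun r hr x hx ↦ ?_) <;>
      simp only [Finset.mem_insert, Finset.mem_singleton] at hr <;> rcases hr with rfl | rfl | rfl
      · exact Or.inr (h19.elim (fun h ↦ D 1 (by decide) h _ h01.symm)
          (fun h ↦ D 9 (by decide) h _ hlast))
      · simp
      · exact Or.inr (D 7 (by decide) m7 _ h67.symm)
      · exact absurd hx (M0 x)
      · exact absurd hx (M2 x)
      · rcases M6 x hx with rfl | rfl
        · exact Or.inr (D 7 (by decide) m7 _ (hnbr 7).symm)
        · simp
    by_cases h3 : u 3 ∈ S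
    · refine G.indepDomNum_lt_of_sdiff B S {u 0, u 2, u 6} {u 0, u 5} hS
        (by simp [Finset.insert_subset_iff, s0, s2, m6])
        (Finset.card_le_two.trans_lt (by simp [hu]))
        (hBS _ (by simp) (by simp) (by simp) (by simp [t5]) (by simp))
        (fun r hr ↦ ?_) (fun r hr x hx ↦ ?_) <;>
      simp only [Finset.mem_insert, Finset.mem_singleton] at hr <;> rcases hr with rfl | rfl | rfl
      · simp
      · exact Or.inr (D 3 (by decide) h3 _ h23.symm)
      · exact Or.inr (D 7 (by decide) m7 _ h67.symm)
      · exact absurd hx (M0 x)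
      · exact absurd hx (M2 x)
      · rcases M6 x hx with rfl | rfl
        · exact Or.inr (D 7 (by decide) m7 _ (hnbr 7).symm)
        · simp
    · have D := hD {u 6} (by simp)
      rw [not_or] at h19
      refine G.indepDomNum_lt_of_sdiff B S {u 6} ∅ hS (by simpa using m6) (by simp)
        (hBS _ (by simp [hvmem]) (Or.inl h19) (Or.inl ⟨h19.1, h3⟩) (by simp [t5]) (by simp))
        (fun r hr ↦ ?_) (fun r hr x hx ↦ ?_) <;>
      rw [Finset.mem_singleton] at hr <;> subst hr
      · exact Or.inr (D 7 (by decide) m7 _ h67.symm)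
      · rcases M6 x hx with rfl | rfl
        · exact Or.inr (D 7 (by decide) m7 _ (hnbr 7).symm)
        · exact Or.inr ⟨u 4, s4 hvmem h3, by simp [hu], h45⟩
  have d5 : ∀ {p : Prop}, u 5 ∉ S ∨ u 4 ∉ S ∨ p :=
    (not_and_or.1 h45S).elim (fun h ↦ Or.inr (Or.inl h)) Or.inl
  have d7 : ∀ {p : Prop}, u 7 ∉ S ∨ u 6 ∉ S ∨ p :=
    (not_and_or.1 h67S).elim (fun h ↦ Or.inr (Or.inl h)) Or.inl
  have D := hD {u 0, u 2} (by simp [Finset.insert_subset_iff])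
  by_cases h19 : u 1 ∈ S ∨ u 9 ∈ S
  · refine G.indepDomNum_lt_of_sdiff B S {u 0, u 2} {u 2} hS
      (by simp [Finset.insert_subset_iff, s0, s2]) (by simp [hu])
      (hBS _ (by simp) (by simp) (by simp) d5 d7)
      (fun r hr ↦ ?_) (fun r hr x hx ↦ ?_) <;>
    simp only [Finset.mem_insert, Finset.mem_singleton] at hr <;> rcases hr with rfl | rfl
    · exact Or.inr (h19.elim (fun h ↦ D 1 (by decide) h _ h01.symm)
        (fun h ↦ D 9 (by decide) h _ hlast))
    · simp
    · exact absurd hx (M0 x)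
    · exact absurd hx (M2 x)
  by_cases h3 : u 3 ∈ S
  · refine G.indepDomNum_lt_of_sdiff B S {u 0, u 2} {u 0} hS
      (by simp [Finset.insert_subset_iff, s0, s2]) (by simp [hu])
      (hBS _ (by simp) (by simp) (by simp) d5 d7)
      (fun r hr ↦ ?_) (fun r hr x hx ↦ ?_) <;>
    simp only [Finset.mem_insert, Finset.mem_singleton] at hr <;> rcases hr with rfl | rfl
    · simp
    · exact Or.inr (D 3 (by decide) h3 _ h23.symm)
    · exact absurd hx (M0 x)
    · exact absurd hx (M2 x)
  have m4 := s4 hvmem h3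
  have t5 : u 5 ∉ S := fun h ↦ h45S ⟨m4, h⟩
  have m6 := s6 hvmem t5
  have t7 : u 7 ∉ S := fun h ↦ h67S ⟨m6, h⟩
  rw [not_or] at h19
  have hS4 : ({u 0, u 2, u 4, u 6} : Finset V) ⊆ S := by
    simp [Finset.insert_subset_iff, s0, s2, m4, m6]
  let T : Finset V := (S \ {u 0, u 2, u 4, u 6}).erase (u 8)
  have hT : T.card + 4 ≤ S.card := by
    have h1 : T.card ≤ _ := Finset.card_erase_le
    have h2 := Finset.card_sdiff_add_card_eq_card hS4
    have h3 : ({u 0, u 2, u 4, u 6} : Finset V).card = 4 := by simp [hu]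
    omega
  have hTS : ∀ x, x ∈ T ↔
      x ∈ S ∧ ¬ (x = u 0 ∨ x = u 2 ∨ x = u 4 ∨ x = u 6 ∨ x = u 8) := by
    intro x
    simp only [T, Finset.mem_erase, Finset.mem_sdiff, Finset.mem_insert, Finset.mem_singleton]
    tauto
  have hTu : ∀ i, u i ∉ T := by
    intro i hi
    obtain ⟨hiS, hi⟩ := (hTS _).1 hi
    simp only [hu] at hi
    fin_cases i <;> first | exact hi (by decide) | exact h19.1 hiS | exact h19.2 hiS | contradiction
  have hvT : ∀ x ∈ T, ¬ G.Adj v x := by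
    intro x hx h
    obtain ⟨i, rfl⟩ := hv x h
    exact hTu i hx
  have key := G.indepDomNum_le_card_add_card (insert v T) W ?_ ?_
  · have := Finset.card_insert_le v T
    omega
  · intro x hx y hy hxy
    rcases Finset.mem_insert.1 hx with rfl | hxT <;> rcases Finset.mem_insert.1 hy with rfl | hyT
    · exact G.irrefl hxy
    · exact hvT y hyT hxy
    · exact hvT x hxT hxy.symm
    · refine hBS (S \ T) (Or.inl hvmem) (Or.inl h19) (Or.inl ⟨h19.1, h3⟩) (Or.inl t5) (Or.inl t7)
        x ((hTS x).1 hxT).1 (by simp [hxT]) y ((hTS y).1 hyT).1 (by simp [hyT])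
        (hindS x ((hTS x).1 hxT).1 y ((hTS y).1 hyT).1 hxy)
  · intro x
    by_cases hxv : x = v
    · simp [hxv]
    by_cases hvx : G.Adj v x
    · exact Or.inr (Or.inl ⟨v, Finset.mem_insert_self v T, hvx⟩)
    have hxu : ∀ i, x ≠ u i := fun i h ↦ hvx (h ▸ hnbr i)
    rcases hdom x with h | ⟨t, ht, h⟩
    · exact Or.inl (Finset.mem_insert_of_mem ((hTS x).2 ⟨h, by simp [hxu]⟩))
    · have htx := (SimpleGraph.deleteEdges_adj.1 h).1.symm
      by_cases htT : t ∈ T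
      · exact Or.inr (Or.inl ⟨t, Finset.mem_insert_of_mem htT, htx⟩)
      · have ht' : t = u 0 ∨ t = u 2 ∨ t = u 4 ∨ t = u 6 ∨ t = u 8 := by
          by_contra hcon
          exact htT ((hTS t).2 ⟨ht, hcon⟩)
        rcases ht' with rfl | rfl | rfl | rfl | rfl
        · simpa [hxv, hxu] using (N0 x).1 htx
        · simpa [hxv, hxu] using (N2 x).1 htx
        · simpa [hxv, hxu] using (N4 x).1 htx
        · simpa [hxv, hxu] using (N6 x).1 htx
        · exact Or.inr (Or.inr (by simpa [hxv, hxu] using N8 x htx))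
end

section
/- Let G be a finite simple graph containing a vertex v of degree 10 with distinct neighbors u_1, …, u_10 such that u_i u_{i+1} ∈ E(G) for i = 1, …, 9 and u_10 u_1 ∈ E(G) (so {v, u_1, …, u_10} is a 10-wheel with hub v). Suppose d(u_1) = d(u_3) = d(u_5) = 3, d(u_7) ≤ 4, d(u_9) ≤ 4, and {u_1, u_3, u_5, u_7, u_9} is an independent set in G. Then there exists a set B of at most 8 edges of G such that γ_i(G − B) > γ_i(G); that is, b_i(G) ≤ 8. -/
open scoped BigOperators

namespace SimpleGraph

variable {V : Type*} [Finite V] {G : SimpleGraph V}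

/-- An independent set that dominates every vertex outside `R` extends, by vertices of `R`,
to an independent dominating set. -/
theorem exists_isIndepDomSet_extension {T R : Set V}
    (hT : ∀ a ∈ T, ∀ b ∈ T, ¬ G.Adj a b)
    (hdom : ∀ z, z ∉ R → z ∈ T ∨ ∃ a ∈ T, G.Adj a z) :
    ∃ S, G.IsIndepDomSet S ∧ S ⊆ T ∪ R := by
  obtain ⟨S, ⟨⟨hTS, hSR, hind⟩, hmax⟩⟩ := (Set.toFinite
    {S : Set V | T ⊆ S ∧ S ⊆ T ∪ R ∧ ∀ a ∈ S, ∀ b ∈ S, ¬ G.Adj a b}).exists_maximal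
    ⟨T, subset_rfl, Set.subset_union_left, hT⟩
  refine ⟨S, ⟨hind, fun z => ?_⟩, hSR⟩
  by_cases hz : z ∈ R
  · by_contra! hcon
    refine hcon.1 (hmax ⟨hTS.trans (Set.subset_insert z S), ?_, ?_⟩
      (Set.subset_insert z S) (Set.mem_insert z S))
    · exact Set.insert_subset (Or.inr hz) hSR
    · rintro a (rfl | ha) b (rfl | hb)
      · exact G.loopless.irrefl _
      · exact fun h => hcon.2 b hb h.symm
      · exact hcon.2 a ha
      · exact hind a ha b hb
  · rcases hdom z hz with h | ⟨a, ha, h⟩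
    · exact Or.inl (hTS h)
    · exact Or.inr ⟨a, hTS ha, h⟩

theorem exists_isIndepDomSet_ncard_eq_indepDomNum (G : SimpleGraph V) :
    ∃ S, G.IsIndepDomSet S ∧ S.ncard = G.indepDomNum := by
  obtain ⟨S, hS, -⟩ := exists_isIndepDomSet_extension (G := G) (T := ∅) (R := Set.univ)
    (by simp) (by simp)
  exact Nat.sInf_mem (s := {n | ∃ S : Set V, G.IsIndepDomSet S ∧ S.ncard = n}) ⟨_, S, hS, rfl⟩

open Classical in
/-- Exchanging the vertices `K` of `S` for the vertices `L`, at the price of leaving at most the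
vertices of `R` undominated, bounds the independent domination number strictly below `S.ncard`
whenever `L` and `R` together are smaller than `K`. -/
theorem indepDomNum_lt_of_exchange {S : Set V} (K L R : Finset V) (hK : ↑K ⊆ S)
    (hcard : L.card + R.card < K.card)
    (hind : ∀ a b, (a ∈ S ∧ a ∉ K ∨ a ∈ L) → (b ∈ S ∧ b ∉ K ∨ b ∈ L) → ¬ G.Adj a b)
    (hdom : ∀ z, z ∉ R → (z ∈ S ∧ z ∉ K ∨ z ∈ L) ∨ ∃ a, (a ∈ S ∧ a ∉ K ∨ a ∈ L) ∧ G.Adj a z) :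
    G.indepDomNum < S.ncard := by
  obtain ⟨S', hS', hsub⟩ := exists_isIndepDomSet_extension
    (T := (S \ ↑K) ∪ ↑L) (R := ↑R) (fun a ha b hb => hind a b ha hb) hdom
  have h1 : G.indepDomNum ≤ S'.ncard := Nat.sInf_le ⟨S', hS', rfl⟩
  have h2 := Set.ncard_le_ncard hsub (Set.toFinite _)
  have h3 := Set.ncard_union_le ((S \ ↑K) ∪ ↑L) (↑R : Set V)
  have h4 := Set.ncard_union_le (S \ ↑K) (↑L : Set V)
  have h5 := Set.ncard_sdiff_add_ncard_of_subset hK (Set.toFinite S)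
  simp only [Set.ncard_coe_finset] at h3 h4 h5
  omega

end SimpleGraph

theorem Set.eq_coe_of_ncard_le_card {V : Type*} [Finite V] {N : Set V} {A : Finset V}
    (hA : ↑A ⊆ N) (h : N.ncard ≤ A.card) : N = ↑A :=
  (Set.eq_of_subset_of_ncard_le hA (by simpa using h) (Set.toFinite N)).symm

open Classical in
theorem Set.exists_subset_insert_of_ncard_le_card_add_one {V : Type*} [Finite V] {N : Set V}
    {A : Finset V} (hA : ↑A ⊆ N) (h : N.ncard ≤ A.card + 1) (hne : A.Nonempty) :
    ∃ x, N ⊆ insert x ↑A := by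
  have h1 := Set.ncard_sdiff_add_ncard_of_subset hA (Set.toFinite N)
  rw [Set.ncard_coe_finset] at h1
  by_cases hx : (N \ ↑A).Nonempty
  · obtain ⟨x, hx⟩ := hx
    refine ⟨x, fun z hz => ?_⟩
    by_cases hzA : z ∈ A
    · exact Or.inr hzA
    · exact Or.inl ((Set.ncard_le_one (Set.toFinite _)).1 (by omega : (N \ ↑A).ncard ≤ 1)
        z ⟨hz, hzA⟩ x hx)
  · obtain ⟨x, -⟩ := hne
    exact ⟨x, (Set.sdiff_eq_empty.1 (Set.not_nonempty_iff_eq_empty.1 hx)).trans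
      (Set.subset_insert _ _)⟩

set_option maxHeartbeats 1000000 in
open Classical in
/-- Let `H` be `G` without the edges at `u 0` and `u 6` and without the edge `u 2 u 3`. Then
every independent dominating set of `H` is larger than the independent domination number of `G`. -/
theorem SimpleGraph.indepDomNum_lt_ncard_of_wheel {V : Type*} [Finite V] {G H : SimpleGraph V}
    {v x y : V} {u : Fin 10 → V} (hinj : Function.Injective u)
    (hv : ∀ z, G.Adj v z ↔ ∃ i, z = u i)
    (h0 : ∀ z, G.Adj (u 0) z ↔ z = v ∨ z = u 9 ∨ z = u 1)
    (h2 : ∀ z, G.Adj (u 2) z ↔ z = v ∨ z = u 1 ∨ z = u 3)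
    (h4 : ∀ z, G.Adj (u 4) z ↔ z = v ∨ z = u 3 ∨ z = u 5)
    (h6 : ∀ z, G.Adj (u 6) z → z = x ∨ z = v ∨ z = u 5 ∨ z = u 7)
    (h8 : ∀ z, G.Adj (u 8) z → z = y ∨ z = v ∨ z = u 7 ∨ z = u 9)
    (h65 : G.Adj (u 6) (u 5)) (h67 : G.Adj (u 6) (u 7))
    (hH : ∀ a b, H.Adj a b ↔ G.Adj a b ∧ a ≠ u 0 ∧ b ≠ u 0 ∧ a ≠ u 6 ∧ b ≠ u 6 ∧
      ¬ (a = u 2 ∧ b = u 3) ∧ ¬ (a = u 3 ∧ b = u 2))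
    {S : Set V} (hS : H.IsIndepDomSet S) : G.indepDomNum < S.ncard := by
  obtain ⟨hind, hdom⟩ := hS
  have hne : ∀ i j, i ≠ j → u i ≠ u j := fun i j hij h => hij (hinj h)
  have hvu : ∀ i, G.Adj v (u i) := fun i => (hv _).2 ⟨i, rfl⟩
  have hvne : ∀ i, v ≠ u i := fun i => (hvu i).ne
  have hindG : ∀ a b, a ∈ S → b ∈ S → G.Adj a b → a = u 0 ∨ b = u 0 ∨ a = u 6 ∨ b = u 6 ∨
      (a = u 2 ∧ b = u 3) ∨ (a = u 3 ∧ b = u 2) := by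
    intro a b ha hb h
    by_contra hc
    exact hind a ha b hb ((hH a b).2 ⟨h, by tauto⟩)
  have hdomG : ∀ z, z ∈ S ∨ ∃ a ∈ S, G.Adj a z ∧ a ≠ u 0 ∧ z ≠ u 0 ∧ a ≠ u 6 ∧ z ≠ u 6 ∧
      ¬ (a = u 3 ∧ z = u 2) := by
    intro z
    rcases hdom z with h | ⟨a, ha, h⟩
    · exact Or.inl h
    · obtain ⟨h1, h2, h3, h4, h5, -, h7⟩ := (hH a z).1 h
      exact Or.inr ⟨a, ha, h1, h2, h3, h4, h5, h7⟩
  clear hind hdom hH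
  have m0 : u 0 ∈ S := (hdomG (u 0)).resolve_right (by tauto)
  have m6 : u 6 ∈ S := (hdomG (u 6)).resolve_right (by tauto)
  have n06 := hne 0 6 (by decide)
  have n02 := hne 0 2 (by decide)
  have n03 := hne 0 3 (by decide)
  have n26 := hne 2 6 (by decide)
  have n23 := hne 2 3 (by decide)
  have n36 := hne 3 6 (by decide)
  have n10 := hne 1 0 (by decide)
  have n12 := hne 1 2 (by decide)
  have n13 := hne 1 3 (by decide)
  have n16 := hne 1 6 (by decide)
  have n90 := hne 9 0 (by decide)
  have n92 := hne 9 2 (by decide)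
  have n96 := hne 9 6 (by decide)
  have hv2 : v ∈ S ∨ u 1 ∈ S ∨ u 2 ∈ S := by
    rcases hdomG (u 2) with h | ⟨a, ha, h, -, -, -, -, h'⟩
    · exact Or.inr (Or.inr h)
    · rcases (h2 a).1 h.symm with rfl | rfl | rfl <;> tauto
  have m12 : u 1 ∈ S → u 2 ∉ S := fun h h' => by
    have := hindG _ _ h h' ((h2 _).2 (Or.inr (Or.inl rfl))).symm
    tauto
  by_cases hvS : v ∈ S
  · have hvi : ∀ i, u i ∈ S → u i = u 0 ∨ u i = u 6 := fun i h => by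
      have h0 := hvne 0
      have h2 := hvne 2
      have h3 := hvne 3
      have h6 := hvne 6
      have := hindG _ _ hvS h (hvu i)
      tauto
    have m2 := hvi 2
    have m3 := hvi 3
    refine G.indepDomNum_lt_of_exchange {u 0, u 6} ∅ ∅ ?_ ?_ ?_ ?_
    · simp [Set.insert_subset_iff, *]
    · simp [n06]
    · clear hv hne hvu hvne hvi h4 h6 h8 hdomG
      grind
    · intro z _
      by_cases hz : z = u 0 ∨ z = u 6
      · refine Or.inr ⟨v, Or.inl ⟨hvS, by simp [hvne]⟩, ?_⟩
        rcases hz with rfl | rfl <;> exact hvu _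
      · rcases hdomG z with h | ⟨a, ha, h, h'⟩
        · exact Or.inl (Or.inl ⟨h, by simpa using hz⟩)
        · exact Or.inr ⟨a, Or.inl ⟨ha, by simp [h']⟩, h⟩
  by_cases m1 : u 1 ∈ S
  · refine G.indepDomNum_lt_of_exchange {u 0, u 6} ∅ {u 6} ?_ ?_ ?_ ?_
    · simp [Set.insert_subset_iff, *]
    · simp [n06]
    · clear hv hne hvu hvne h4 h6 h8 hdomG
      grind
    · intro z hz6
      by_cases hz : z = u 0
      · exact Or.inr ⟨u 1, Or.inl ⟨m1, by simp [n10, n16]⟩, hz ▸ ((h0 _).2 (by tauto)).symm⟩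
      · rcases hdomG z with h | ⟨a, ha, h, h'⟩
        · exact Or.inl (Or.inl ⟨h, by simpa [hz] using hz6⟩)
        · exact Or.inr ⟨a, Or.inl ⟨ha, by simp [h']⟩, h⟩
  have m2 : u 2 ∈ S := by tauto
  by_cases m9 : u 9 ∈ S
  · have d0 : G.Adj (u 9) (u 0) := ((h0 _).2 (by tauto)).symm
    by_cases m3 : u 3 ∈ S
    · have d2 : G.Adj (u 3) (u 2) := ((h2 _).2 (by tauto)).symm
      refine G.indepDomNum_lt_of_exchange {u 0, u 2, u 6} ∅ {u 1, u 6} ?_ ?_ ?_ ?_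
      · simp [Set.insert_subset_iff, *]
      · simp [n06, n02, n26, n16]
      · clear hv hne hvu hvne h4 h6 h8 hdomG
        grind
      · intro z hz
        have d3 := hvu 3
        rcases hdomG z with h | ⟨a, ha, h, h'⟩
        · clear hv hne hvu hvne h0 h2 h4 h6 h8 hdomG hindG
          grind
        · by_cases ha2 : a = u 2
          · subst ha2
            have h2z := (h2 z).1 h
            have := d3.symm
            clear hv hne hvu hvne h0 h2 h4 h6 h8 hdomG hindG
            grind
          · exact Or.inr ⟨a, Or.inl ⟨ha, by simp [h', ha2]⟩, h⟩
    · refine G.indepDomNum_lt_of_exchange {u 0, u 6} ∅ {u 6} ?_ ?_ ?_ ?_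
      · simp [Set.insert_subset_iff, *]
      · simp [n06]
      · clear hv hne hvu hvne h4 h6 h8 hdomG
        grind
      · intro z hz6
        by_cases hz : z = u 0
        · exact Or.inr ⟨u 9, Or.inl ⟨m9, by simp [n90, n96]⟩, hz ▸ d0⟩
        · rcases hdomG z with h | ⟨a, ha, h, h'⟩
          · exact Or.inl (Or.inl ⟨h, by simpa [hz] using hz6⟩)
          · exact Or.inr ⟨a, Or.inl ⟨ha, by simp [h']⟩, h⟩
  have h0S : ∀ a ∈ S, ¬ G.Adj (u 0) a := fun a ha h => by
    rcases (h0 a).1 h with rfl | rfl | rfl <;> contradiction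
  have h0S' : ∀ a ∈ S, ¬ G.Adj a (u 0) := fun a ha h => h0S a ha h.symm
  by_cases m3 : u 3 ∈ S
  · have d2 : G.Adj (u 3) (u 2) := ((h2 _).2 (by tauto)).symm
    have d3 := (hvu 3).symm
    have d1 : G.Adj (u 0) (u 1) := (h0 _).2 (by tauto)
    refine G.indepDomNum_lt_of_exchange {u 2, u 6} ∅ {u 6} ?_ ?_ ?_ ?_
    · simp [Set.insert_subset_iff, *]
    · simp [n26]
    · clear hv hne hvu hvne h0 h2 h4 h6 h8 hdomG
      grind
    · intro z hz
      rcases hdomG z with h | ⟨a, ha, h, h'⟩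
      · clear hv hne hvu hvne h0 h2 h4 h6 h8 hdomG hindG
        grind
      · by_cases ha2 : a = u 2
        · subst ha2
          have h2z := (h2 z).1 h
          clear hv hne hvu hvne h0 h2 h4 h6 h8 hdomG hindG
          grind
        · exact Or.inr ⟨a, Or.inl ⟨ha, by simp [h', ha2]⟩, h⟩
  by_cases mN : ∃ z ∈ S, G.Adj (u 6) z
  · obtain ⟨w, hw, h6w⟩ := mN
    have hw6 : w ≠ u 6 := h6w.ne'
    refine G.indepDomNum_lt_of_exchange {u 6} ∅ ∅ ?_ ?_ ?_ ?_
    · simpa using m6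
    · simp
    · clear hv hne hvu hvne h0 h2 h4 h6 h8 hdomG
      grind
    · intro z _
      by_cases hz : z = u 6
      · exact Or.inr ⟨w, Or.inl ⟨hw, by simpa using hw6⟩, hz ▸ h6w.symm⟩
      · rcases hdomG z with h | ⟨a, ha, h, h'⟩
        · exact Or.inl (Or.inl ⟨h, by simpa using hz⟩)
        · exact Or.inr ⟨a, Or.inl ⟨ha, by simp [h']⟩, h⟩
  have m5 : u 5 ∉ S := fun h => mN ⟨_, h, h65⟩
  have m7 : u 7 ∉ S := fun h => mN ⟨_, h, h67⟩
  have m4 : u 4 ∈ S := by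
    rcases hdomG (u 4) with h | ⟨a, ha, h, -⟩
    · exact h
    · rcases (h4 a).1 h.symm with rfl | rfl | rfl <;> contradiction
  have hvEven : ∀ a ∈ S, G.Adj v a → a = u 0 ∨ a = u 2 ∨ a = u 4 ∨ a = u 6 ∨ a = u 8 := by
    intro a ha h
    obtain ⟨i, rfl⟩ := (hv a).1 h
    fin_cases i <;> simp_all
  have hSu : ∀ a ∈ S, ∀ b ∈ S, G.Adj a b → a = u 6 ∨ b = u 6 := by
    intro a ha b hb h
    have := hindG a b ha hb h
    have := h0S a ha
    have := h0S b hb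
    have := h.symm
    clear hv hne hvu hvne h0 h2 h4 h6 h8 hdomG
    grind
  have hzS : ∀ z, (∃ i, z = u i) ∨ z = v ∨ z = x ∨ (z ∈ S ∧ ∀ i, z ≠ u i) ∨
      ∃ a ∈ S, G.Adj a z ∧ a ≠ u 0 ∧ a ≠ u 2 ∧ a ≠ u 4 ∧ a ≠ u 6 ∧ (a = u 8 → z = y) := by
    intro z
    by_cases hz : ∃ i, z = u i
    · exact Or.inl hz
    have hz' : ∀ i, z ≠ u i := fun i h => hz ⟨i, h⟩
    rcases hdomG z with h | ⟨a, ha, h, ha0, -, ha6, -⟩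
    · tauto
    by_cases hzv : z = v
    · tauto
    refine Or.inr (Or.inr (Or.inr (Or.inr ⟨a, ha, h, ha0, ?_, ?_, ha6, ?_⟩)))
    · rintro rfl
      have := (h2 z).1 h
      simp_all
    · rintro rfl
      have := (h4 z).1 h
      simp_all
    · rintro rfl
      have := h8 z h
      simp_all
  by_cases m8 : u 8 ∈ S
  · refine G.indepDomNum_lt_of_exchange {u 0, u 2, u 4, u 6, u 8} {v} {x, y} ?_ ?_ ?_ ?_
    · simp [Set.insert_subset_iff, *]
    · have h1 := Finset.card_le_two (a := x) (b := y)
      have h2 : ({u 0, u 2, u 4, u 6, u 8} : Finset V).card = 5 := by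
        have := Finset.card_image_of_injective {0, 2, 4, 6, 8} hinj
        simpa [Finset.image_insert] using this
      simp only [Finset.card_singleton]
      omega
    · have hs : ∀ a ∈ S, G.Adj a v → G.Adj v a := fun a _ h => h.symm
      have hvv : ¬ G.Adj v v := G.loopless.irrefl v
      clear hv hne hvu hvne h0 h2 h4 h6 h8 hdomG hindG hzS
      grind
    · intro z hz
      rcases hzS z with ⟨i, rfl⟩ | rfl | rfl | ⟨h, h'⟩ | ⟨a, ha, h, h'⟩
      · exact Or.inr ⟨v, by simp, hvu i⟩
      · simp
      · simp at hz
      · exact Or.inl (Or.inl ⟨h, by simp [h']⟩)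
      · refine Or.inr ⟨a, Or.inl ⟨ha, ?_⟩, h⟩
        have : a ≠ u 8 := fun h => hz (by simp [h'.2.2.2.2 h])
        simp [h', this]
  · refine G.indepDomNum_lt_of_exchange {u 0, u 2, u 4, u 6} {v} {x} ?_ ?_ ?_ ?_
    · simp [Set.insert_subset_iff, *]
    · have h2 : ({u 0, u 2, u 4, u 6} : Finset V).card = 4 := by
        have := Finset.card_image_of_injective {0, 2, 4, 6} hinj
        simpa [Finset.image_insert] using this
      simp [h2]
    · have hs : ∀ a ∈ S, G.Adj a v → G.Adj v a := fun a _ h => h.symm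
      have hvv : ¬ G.Adj v v := G.loopless.irrefl v
      clear hv hne hvu hvne h0 h2 h4 h6 h8 hdomG hindG hzS
      grind
    · intro z hz
      rcases hzS z with ⟨i, rfl⟩ | rfl | rfl | ⟨h, h'⟩ | ⟨a, ha, h, h'⟩
      · exact Or.inr ⟨v, by simp, hvu i⟩
      · simp
      · simp at hz
      · exact Or.inl (Or.inl ⟨h, by simp [h']⟩)
      · refine Or.inr ⟨a, Or.inl ⟨ha, ?_⟩, h⟩
        simp [h']

theorem stmt4 {V : Type*} [Fintype V]
    (G : SimpleGraph V) (v : V) (u : Fin 10 → V)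
    (hinj : Function.Injective u)
    (hdeg : (G.neighborSet v).ncard = 10)
    (hnbr : ∀ i, G.Adj v (u i))
    (hcyc : ∀ i : Fin 10, i.val < 9 → G.Adj (u i) (u (i + 1)))
    (hlast : G.Adj (u 9) (u 0))
    (hd1 : (G.neighborSet (u 0)).ncard = 3)
    (hd3 : (G.neighborSet (u 2)).ncard = 3)
    (hd5 : (G.neighborSet (u 4)).ncard = 3)
    (hd7 : (G.neighborSet (u 6)).ncard ≤ 4)
    (hd9 : (G.neighborSet (u 8)).ncard ≤ 4)
    (hind : ∀ i ∈ ({0, 2, 4, 6, 8} : Finset (Fin 10)),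
      ∀ j ∈ ({0, 2, 4, 6, 8} : Finset (Fin 10)), ¬ G.Adj (u i) (u j)) :
    ∃ B : Finset (Sym2 V), ↑B ⊆ G.edgeSet ∧ B.card ≤ 8 ∧
      G.indepDomNum < (G.deleteEdges ↑B).indepDomNum := by
  classical
  have hne : ∀ i j, i ≠ j → u i ≠ u j := fun i j hij h => hij (hinj h)
  have hvne : ∀ i, v ≠ u i := fun i => (hnbr i).ne
  have hcard : ∀ i j, i ≠ j → ({v, u i, u j} : Finset V).card = 3 := fun i j hij => by
    rw [Finset.card_eq_three]
    exact ⟨v, u i, u j, hvne i, hvne j, hne i j hij, rfl⟩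
  have hsub : ∀ k i j, G.Adj (u k) (u i) → G.Adj (u k) (u j) →
      (↑({v, u i, u j} : Finset V) : Set V) ⊆ G.neighborSet (u k) := by
    intro k i j hi hj z hz
    simp only [Finset.coe_insert, Finset.coe_singleton, Set.mem_insert_iff,
      Set.mem_singleton_iff] at hz
    rcases hz with rfl | rfl | rfl
    · exact (hnbr k).symm
    · exact hi
    · exact hj
  have hthree : ∀ k i j, i ≠ j → G.Adj (u k) (u i) → G.Adj (u k) (u j) →
      (G.neighborSet (u k)).ncard = 3 → ∀ z, G.Adj (u k) z ↔ z = v ∨ z = u i ∨ z = u j := by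
    intro k i j hij hi hj hd z
    have h := Set.eq_coe_of_ncard_le_card (hsub k i j hi hj) (by rw [hcard i j hij, hd])
    rw [← G.mem_neighborSet, h]
    simp
  have hfour : ∀ k i j, i ≠ j → G.Adj (u k) (u i) → G.Adj (u k) (u j) →
      (G.neighborSet (u k)).ncard ≤ 4 →
      ∃ x, ∀ z, G.Adj (u k) z → z = x ∨ z = v ∨ z = u i ∨ z = u j := by
    intro k i j hij hi hj hd
    obtain ⟨x, hx⟩ := Set.exists_subset_insert_of_ncard_le_card_add_one (hsub k i j hi hj)
      (by rw [hcard i j hij]; exact hd) ⟨v, by simp⟩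
    exact ⟨x, fun z hz => by simpa using hx hz⟩
  have hv : ∀ z, G.Adj v z ↔ ∃ i, z = u i := by
    intro z
    have h := Set.eq_coe_of_ncard_le_card (N := G.neighborSet v) (A := Finset.univ.image u)
      (by intro z hz; obtain ⟨i, rfl⟩ : ∃ i, u i = z := by simpa using hz
          exact hnbr i)
      (by rw [hdeg, Finset.card_image_of_injective _ hinj]; simp)
    rw [← G.mem_neighborSet, h]
    simp [eq_comm]
  have h0 := hthree 0 9 1 (by decide) hlast.symm (hcyc 0 (by decide)) hd1
  have h2 := hthree 2 1 3 (by decide) (hcyc 1 (by decide)).symm (hcyc 2 (by decide)) hd3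
  have h4 := hthree 4 3 5 (by decide) (hcyc 3 (by decide)).symm (hcyc 4 (by decide)) hd5
  have h65 : G.Adj (u 6) (u 5) := (hcyc 5 (by decide)).symm
  have h67 : G.Adj (u 6) (u 7) := hcyc 6 (by decide)
  obtain ⟨x, h6⟩ := hfour 6 5 7 (by decide) h65 h67 hd7
  obtain ⟨y, h8⟩ := hfour 8 7 9 (by decide) (hcyc 7 (by decide)).symm (hcyc 8 (by decide)) hd9
  refine ⟨insert s(u 2, u 3) (G.incidenceFinset (u 0) ∪ G.incidenceFinset (u 6)), ?_, ?_, ?_⟩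
  · intro e he
    simp only [Finset.coe_insert, Finset.coe_union, SimpleGraph.coe_incidenceFinset,
      Set.mem_insert_iff, Set.mem_union] at he
    rcases he with rfl | he | he
    · exact hcyc 2 (by decide)
    · exact he.1
    · exact he.1
  · have hc : ∀ w, (G.incidenceFinset w).card = (G.neighborSet w).ncard := fun w => by
      rw [G.card_incidenceFinset_eq_degree, Set.ncard_eq_toFinset_card']
      rfl
    have i1 := Finset.card_insert_le s(u 2, u 3)
      (G.incidenceFinset (u 0) ∪ G.incidenceFinset (u 6))
    have i2 := Finset.card_union_le (G.incidenceFinset (u 0)) (G.incidenceFinset (u 6))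
    rw [hc, hc, hd1] at i2
    omega
  · obtain ⟨S, hS, hScard⟩ := SimpleGraph.exists_isIndepDomSet_ncard_eq_indepDomNum
      (G.deleteEdges ↑(insert s(u 2, u 3) (G.incidenceFinset (u 0) ∪ G.incidenceFinset (u 6))))
    rw [← hScard]
    refine SimpleGraph.indepDomNum_lt_ncard_of_wheel hinj hv h0 h2 h4 h6 h8 h65 h67 ?_ hS
    intro a b
    simp only [SimpleGraph.deleteEdges_adj, Finset.coe_insert, Finset.coe_union,
      SimpleGraph.coe_incidenceFinset, Set.mem_insert_iff, Set.mem_union,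
      SimpleGraph.mk'_mem_incidenceSet_iff, Sym2.eq_iff]
    grind
end

section
/- Let G be a finite simple graph containing a vertex v of degree 9 with distinct neighbors u_1, …, u_9 such that u_i u_{i+1} ∈ E(G) for i = 1, …, 8 and u_9 u_1 ∈ E(G) (so {v, u_1, …, u_9} is a 9-wheel with hub v). Suppose d(u_1) = d(u_3) = 3, d(u_5) ≤ 4, d(u_7) ≤ 4, and {u_1, u_3, u_5, u_7} is an independent set in G. Then there exists a set B of at most 8 edges of G such that γ_i(G − B) > γ_i(G); that is, b_i(G) ≤ 8. -/
open scoped BigOperators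

namespace SimpleGraph

variable {V : Type*} [Finite V] {G H : SimpleGraph V}

theorem exists_isIndepDomSet (G : SimpleGraph V) : ∃ S, G.IsIndepDomSet S := by
  obtain ⟨S, -, hS⟩ := (Set.toFinite {S : Set V | ∀ a ∈ S, ∀ b ∈ S, ¬ G.Adj a b}).exists_le_maximal
    (a := ∅) (by simp)
  refine ⟨S, hS.prop, fun x => ?_⟩
  by_contra! hx
  refine hx.1 (hS.le_of_ge (y := insert x S) ?_ (Set.subset_insert x S) (Set.mem_insert x S))
  rintro a (rfl | ha) b (rfl | hb)
  · exact G.irrefl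
  · exact fun h => hx.2 b hb h.symm
  · exact hx.2 a ha
  · exact hS.prop a ha b hb

theorem indepDomNum_lt_of_forall
    (h : ∀ S, H.IsIndepDomSet S → ∃ T, G.IsIndepDomSet T ∧ T.ncard < S.ncard) :
    G.indepDomNum < H.indepDomNum := by
  obtain ⟨S₀, hS₀⟩ := H.exists_isIndepDomSet
  obtain ⟨S, hS, hcard⟩ :=
    Nat.sInf_mem (s := {n | ∃ S : Set V, H.IsIndepDomSet S ∧ S.ncard = n}) ⟨_, S₀, hS₀, rfl⟩
  obtain ⟨T, hT, hlt⟩ := h S hS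
  calc G.indepDomNum ≤ T.ncard := Nat.sInf_le ⟨T, hT, rfl⟩
    _ < S.ncard := hlt
    _ = H.indepDomNum := hcard

/-- An independent dominating set `S` of `G` can be shrunk by trading three or four neighbors of a
vertex `v` for `v` and at most one further vertex. -/
theorem IsIndepDomSet.exists_ncard_lt {S : Set V} {v p q r t x : V} (hS : G.IsIndepDomSet S)
    (hpS : p ∈ S) (hqS : q ∈ S) (hrS : r ∈ S)
    (hpq : p ≠ q) (hpr : p ≠ r) (hqr : q ≠ r) (htp : t ≠ p) (htq : t ≠ q) (htr : t ≠ r)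
    (hvp : G.Adj v p) (hvq : G.Adj v q) (hvr : G.Adj v r) (hvt : G.Adj v t)
    (ht : ∀ a, G.Adj t a → a = v ∨ G.Adj v a ∨ a = x)
    (hv : ∀ w ∈ S, G.Adj v w → w = p ∨ w = q ∨ w = r ∨ w = t)
    (hdom : ∀ z, z = v ∨ z ∈ S ∨ ∃ s ∈ S, s ≠ p ∧ s ≠ q ∧ s ≠ r ∧ G.Adj s z) :
    ∃ T, G.IsIndepDomSet T ∧ T.ncard < S.ncard := by
  set T : Set V := insert v (S \ {p, q, r, t}) with hT
  have mem_T : ∀ a, a ∈ T ↔ a = v ∨ a ∈ S ∧ a ≠ p ∧ a ≠ q ∧ a ≠ r ∧ a ≠ t := by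
    intro a
    simp [hT]
  have hindep : ∀ a ∈ T, ∀ b ∈ T, ¬ G.Adj a b := by
    intro a ha b hb hab
    rw [mem_T] at ha hb
    rcases ha with rfl | ha <;> rcases hb with rfl | hb
    · exact G.irrefl hab
    · have := hv b hb.1 hab
      tauto
    · have := hv a ha.1 hab.symm
      tauto
    · exact hS.1 a ha.1 b hb.1 hab
  have hnear : ∀ z, (z ∈ T ∨ ∃ s ∈ T, G.Adj s z) ∨ t ∈ S ∧ z = x := by
    intro z
    have hadj : G.Adj v z → (z ∈ T ∨ ∃ s ∈ T, G.Adj s z) :=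
      fun h => .inr ⟨v, (mem_T v).2 (.inl rfl), h⟩
    rcases hdom z with rfl | hz | ⟨s, hs, h1, h2, h3, hsz⟩
    · exact .inl (.inl ((mem_T z).2 (.inl rfl)))
    · by_cases h : z = p ∨ z = q ∨ z = r ∨ z = t
      · rcases h with rfl | rfl | rfl | rfl <;> exact .inl (hadj ‹_›)
      · exact .inl (.inl ((mem_T z).2 (.inr (by tauto))))
    · by_cases hst : s = t
      · subst hst
        rcases ht z hsz with rfl | h | h
        · exact .inl (.inl ((mem_T z).2 (.inl rfl)))
        · exact .inl (hadj h)
        · exact .inr ⟨hs, h⟩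
      · exact .inl (.inr ⟨s, (mem_T s).2 (.inr ⟨hs, h1, h2, h3, hst⟩), hsz⟩)
  have hTcard : T.ncard ≤ (S \ {p, q, r, t}).ncard + 1 := Set.ncard_insert_le _ _
  have hpqr : ({p, q, r} : Set V).ncard = 3 := Set.ncard_eq_three.2 ⟨p, q, r, hpq, hpr, hqr, rfl⟩
  by_cases hx : t ∈ S ∧ ¬ (x ∈ T ∨ ∃ s ∈ T, G.Adj s x)
  · obtain ⟨htS, hx⟩ := hx
    push Not at hx
    refine ⟨insert x T, ⟨?_, fun z => ?_⟩, ?_⟩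
    · rintro a (rfl | ha) b (rfl | hb)
      · exact G.irrefl
      · exact fun h => hx.2 b hb h.symm
      · exact hx.2 a ha
      · exact hindep a ha b hb
    · rcases hnear z with (h | ⟨s, hs, h⟩) | ⟨-, rfl⟩
      · exact .inl (.inr h)
      · exact .inr ⟨s, .inr hs, h⟩
      · exact .inl (.inl rfl)
    · have hfour : ({p, q, r, t} : Set V).ncard = 4 := by
        rw [show ({p, q, r, t} : Set V) = insert t {p, q, r} by ext; simp; tauto,
          Set.ncard_insert_of_notMem (by simp [htp, htq, htr]), hpqr]
      have hsub : ({p, q, r, t} : Set V) ⊆ S := by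
        rintro a (rfl | rfl | rfl | rfl) <;> assumption
      have := Set.ncard_sdiff_add_ncard_of_subset hsub
      have := Set.ncard_insert_le x T
      lia
  · refine ⟨T, ⟨hindep, fun z => ?_⟩, ?_⟩
    · rcases hnear z with h | ⟨htS, rfl⟩
      · exact h
      · by_contra h
        exact hx ⟨htS, h⟩
    · have hsub : ({p, q, r} : Set V) ⊆ S := by
        rintro a (rfl | rfl | rfl) <;> assumption
      have := Set.ncard_sdiff_add_ncard_of_subset hsub
      have : (S \ {p, q, r, t}).ncard ≤ (S \ {p, q, r}).ncard := by
        refine Set.ncard_le_ncard fun a => ?_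
        simp
        tauto
      lia

/-- Here `H` is obtained from `G` by isolating `p` and turning `q` and `r` into leaves attached
to `v`. -/
theorem indepDomNum_lt_of_pendant {v p q r t x : V}
    (hpq : p ≠ q) (hpr : p ≠ r) (hqr : q ≠ r) (htp : t ≠ p) (htq : t ≠ q) (htr : t ≠ r)
    (hvp : G.Adj v p) (hvq : G.Adj v q) (hvr : G.Adj v r) (hvt : G.Adj v t)
    (hpq_adj : ¬ G.Adj p q) (hpr_adj : ¬ G.Adj p r) (hqr_adj : ¬ G.Adj q r)
    (hp : ∀ a, G.Adj p a → a = v ∨ G.Adj v a)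
    (hq : ∀ a, G.Adj q a → a = v ∨ G.Adj v a)
    (ht : ∀ a, G.Adj t a → a = v ∨ G.Adj v a ∨ a = x)
    (hv : ∀ w, G.Adj v w →
      (w = p ∨ w = q ∨ w = r ∨ w = t) ∨ G.Adj w p ∨ G.Adj w q ∨ G.Adj w r)
    (hle : H ≤ G)
    (hHp : ∀ a, ¬ H.Adj p a) (hHq : ∀ a, H.Adj q a ↔ a = v) (hHr : ∀ a, H.Adj r a ↔ a = v)
    (hH : ∀ a b, a ≠ p → a ≠ q → a ≠ r → b ≠ p → b ≠ q → b ≠ r → G.Adj a b → H.Adj a b) :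
    G.indepDomNum < H.indepDomNum := by
  refine indepDomNum_lt_of_forall fun S hS => ?_
  have hpS : p ∈ S := (hS.2 p).resolve_right fun ⟨s, _, h⟩ => hHp s h.symm
  by_cases hvS : v ∈ S
  · have hqS : q ∉ S := fun h => hS.1 q h v hvS ((hHq v).2 rfl)
    have hrS : r ∉ S := fun h => hS.1 r h v hvS ((hHr v).2 rfl)
    refine ⟨S \ {p}, ⟨?_, fun z => ?_⟩, Set.ncard_sdiff_singleton_lt_of_mem hpS⟩
    · rintro a ⟨ha, hap⟩ b ⟨hb, hbp⟩ hab
      exact hS.1 a ha b hb (hH a b hap (ne_of_mem_of_not_mem ha hqS) (ne_of_mem_of_not_mem ha hrS)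
        hbp (ne_of_mem_of_not_mem hb hqS) (ne_of_mem_of_not_mem hb hrS) hab)
    · by_cases hzp : z = p
      · exact .inr ⟨v, ⟨hvS, hvp.ne⟩, hzp ▸ hvp⟩
      · rcases hS.2 z with hz | ⟨s, hs, h⟩
        · exact .inl ⟨hz, hzp⟩
        · refine .inr ⟨s, ⟨hs, ?_⟩, hle h⟩
          rintro rfl
          exact hHp z h
  have hqS : q ∈ S := (hS.2 q).resolve_right fun ⟨s, hs, h⟩ => hvS ((hHq s).1 h.symm ▸ hs)
  have hrS : r ∈ S := (hS.2 r).resolve_right fun ⟨s, hs, h⟩ => hvS ((hHr s).1 h.symm ▸ hs)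
  -- Whatever is not in `S ∪ {v}` is dominated by a vertex other than `p`, `q`, `r`.
  have hdom : ∀ z, z = v ∨ z ∈ S ∨ ∃ s ∈ S, s ≠ p ∧ s ≠ q ∧ s ≠ r ∧ G.Adj s z := by
    intro z
    by_cases hzv : z = v
    · exact .inl hzv
    · refine .inr ((hS.2 z).imp_right fun ⟨s, hs, h⟩ => ⟨s, hs, ?_, ?_, ?_, hle h⟩)
      · rintro rfl
        exact hHp z h
      · rintro rfl
        exact hzv ((hHq z).1 h)
      · rintro rfl
        exact hzv ((hHr z).1 h)
  by_cases hSG : ∀ a ∈ S, ∀ b ∈ S, ¬ G.Adj a b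
  · have hSG' : G.IsIndepDomSet S :=
      ⟨hSG, fun z => (hS.2 z).imp_right fun ⟨s, hs, h⟩ => ⟨s, hs, hle h⟩⟩
    refine hSG'.exists_ncard_lt hpS hqS hrS hpq hpr hqr htp htq htr hvp hvq hvr hvt ht ?_ hdom
    intro w hw hvw
    refine (hv w hvw).resolve_right ?_
    rintro (h | h | h)
    · exact hSG w hw p hpS h
    · exact hSG w hw q hqS h
    · exact hSG w hw r hrS h
  -- Otherwise delete from `S` those of `p`, `q`, `r` that have a `G`-neighbor in `S`.
  have hbad : ∀ a ∈ S, ∀ b ∈ S, G.Adj a b → (a = p ∨ a = q ∨ a = r) ∨ b = p ∨ b = q ∨ b = r := by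
    intro a ha b hb hab
    by_contra! h
    exact hS.1 a ha b hb
      (hH a b h.1.1 h.1.2.1 h.1.2.2 h.2.1 h.2.2.1 h.2.2.2 hab)
  have hpqr : ∀ a b, (a = p ∨ a = q ∨ a = r) → (b = p ∨ b = q ∨ b = r) → ¬ G.Adj a b := by
    rintro a b (rfl | rfl | rfl) (rfl | rfl | rfl) <;> simp_all [G.adj_comm]
  set T : Set V := {a ∈ S | (a = p ∨ a = q ∨ a = r) → ∀ b ∈ S, ¬ G.Adj a b}
  have hkeep : ∀ a ∈ S, ¬ (a = p ∨ a = q ∨ a = r) → a ∈ T :=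
    fun a ha h => ⟨ha, fun h' => (h h').elim⟩
  have hTdom : ∀ z ∈ S, z ∈ T ∨ ∃ s ∈ T, G.Adj s z := by
    intro z hz
    by_cases hzT : z ∈ T
    · exact .inl hzT
    · have : (z = p ∨ z = q ∨ z = r) ∧ ∃ b ∈ S, G.Adj z b := by
        by_contra h
        exact hzT ⟨hz, fun h1 b hb hzb => h ⟨h1, b, hb, hzb⟩⟩
      obtain ⟨h1, b, hb, hzb⟩ := this
      exact .inr ⟨b, hkeep b hb fun h => hpqr z b h1 h hzb, hzb.symm⟩
  refine ⟨T, ⟨?_, fun z => ?_⟩, ?_⟩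
  · rintro a ⟨ha, ha'⟩ b ⟨hb, hb'⟩ hab
    rcases hbad a ha b hb hab with h | h
    · exact ha' h b hb hab
    · exact hb' h a ha hab.symm
  · rcases hdom z with rfl | hz | ⟨s, hs, h1, h2, h3, hsz⟩
    · rcases hTdom p hpS with h | ⟨s, hs, h⟩
      · exact .inr ⟨p, h, hvp.symm⟩
      · rcases hp s h.symm with rfl | h'
        · exact .inl hs
        · exact .inr ⟨s, hs, h'.symm⟩
    · exact hTdom z hz
    · exact .inr ⟨s, hkeep s hs (by tauto), hsz⟩
  · push Not at hSG
    obtain ⟨a, ha, b, hb, hab⟩ := hSG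
    refine Set.ncard_lt_ncard ((Set.ssubset_iff_of_subset fun _ h => h.1).2 ?_)
    rcases hbad a ha b hb hab with h | h
    · exact ⟨a, ha, fun haT => haT.2 h b hb hab⟩
    · exact ⟨b, hb, fun hbT => hbT.2 h a ha hab.symm⟩

end SimpleGraph

theorem stmt6 {V : Type*} [Fintype V]
    (G : SimpleGraph V) (v : V) (u : Fin 9 → V)
    (hinj : Function.Injective u)
    (hdeg : (G.neighborSet v).ncard = 9)
    (hnbr : ∀ i, G.Adj v (u i))
    (hcyc : ∀ i : Fin 9, i.val < 8 → G.Adj (u i) (u (i + 1)))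
    (hlast : G.Adj (u 8) (u 0))
    (hd1 : (G.neighborSet (u 0)).ncard = 3)
    (hd3 : (G.neighborSet (u 2)).ncard = 3)
    (hd5 : (G.neighborSet (u 4)).ncard ≤ 4)
    (hd7 : (G.neighborSet (u 6)).ncard ≤ 4)
    (hind : ∀ i ∈ ({0, 2, 4, 6} : Finset (Fin 9)),
      ∀ j ∈ ({0, 2, 4, 6} : Finset (Fin 9)), ¬ G.Adj (u i) (u j)) :
    ∃ B : Finset (Sym2 V), ↑B ⊆ G.edgeSet ∧ B.card ≤ 8 ∧
      G.indepDomNum < (G.deleteEdges ↑B).indepDomNum := by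
  classical
  have hne : ∀ i j : Fin 9, i ≠ j → u i ≠ u j := fun i j h h' => h (hinj h')
  have h01 := hcyc 0 (by decide)
  have h12 := hcyc 1 (by decide)
  have h23 := hcyc 2 (by decide)
  have h34 := hcyc 3 (by decide)
  have h45 := hcyc 4 (by decide)
  have h56 := hcyc 5 (by decide)
  have h67 := hcyc 6 (by decide)
  norm_num at h01 h12 h23 h34 h45 h56 h67
  have hNv : ∀ w, G.Adj v w → ∃ i, w = u i := by
    have : Set.range u = G.neighborSet v := by
      refine Set.eq_of_subset_of_ncard_le (Set.range_subset_iff.2 hnbr) ?_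
      rw [hdeg, ← Set.image_univ, Set.ncard_image_of_injective _ hinj]
      simp [Set.ncard_univ]
    intro w hw
    obtain ⟨i, hi⟩ := this.symm.subset hw
    exact ⟨i, hi.symm⟩
  have hthree : ∀ i j : Fin 9, i ≠ j → ({v, u i, u j} : Set V).ncard = 3 := fun i j hij =>
    Set.ncard_eq_three.2 ⟨v, u i, u j, (hnbr i).ne, (hnbr j).ne, hne i j hij, rfl⟩
  have hclosed : ∀ k i j : Fin 9, i ≠ j → G.Adj (u k) (u i) → G.Adj (u k) (u j) →
      (G.neighborSet (u k)).ncard = 3 → ∀ a, G.Adj (u k) a → a = v ∨ G.Adj v a := by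
    intro k i j hij hi hj hk a ha
    have hsub : ({v, u i, u j} : Set V) ⊆ G.neighborSet (u k) := by
      rintro _ (rfl | rfl | rfl)
      exacts [(hnbr k).symm, hi, hj]
    have := Set.eq_of_subset_of_ncard_le hsub (by rw [hk, hthree i j hij])
    rcases this.symm.subset ha with rfl | rfl | rfl
    exacts [.inl rfl, .inr (hnbr i), .inr (hnbr j)]
  obtain ⟨x, hx⟩ : ∃ x, ∀ a, G.Adj (u 4) a → a = v ∨ G.Adj v a ∨ a = x := by
    have hsub : ({v, u 3, u 5} : Set V) ⊆ G.neighborSet (u 4) := by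
      rintro _ (rfl | rfl | rfl)
      exacts [(hnbr 4).symm, h34.symm, h45]
    have hcard := Set.ncard_sdiff_add_ncard_of_subset hsub
    rw [hthree 3 5 (by decide)] at hcard
    have : Nonempty V := ⟨v⟩
    obtain ⟨x, hx⟩ := (Set.ncard_le_one_iff_subset_singleton
      (s := G.neighborSet (u 4) \ {v, u 3, u 5})).1 (by lia)
    refine ⟨x, fun a ha => ?_⟩
    by_cases h : a ∈ ({v, u 3, u 5} : Set V)
    · rcases h with rfl | rfl | rfl
      exacts [.inl rfl, .inr (.inl (hnbr 3)), .inr (.inl (hnbr 5))]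
    · exact .inr (.inr (hx ⟨ha, h⟩))
  let star (w : V) (N : Set V) : Finset (Sym2 V) := N.toFinset.image fun a => s(w, a)
  have star_card : ∀ w N, (star w N).card ≤ N.ncard := fun w N =>
    Finset.card_image_le.trans (Set.ncard_eq_toFinset_card' N).ge
  let B : Finset (Sym2 V) := star (u 0) (G.neighborSet (u 0)) ∪
    (star (u 2) (G.neighborSet (u 2) \ {v}) ∪ star (u 6) (G.neighborSet (u 6) \ {v}))
  have mem_B : ∀ e, e ∈ B ↔ (∃ a, G.Adj (u 0) a ∧ s(u 0, a) = e) ∨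
      (∃ a, (G.Adj (u 2) a ∧ a ≠ v) ∧ s(u 2, a) = e) ∨
      ∃ a, (G.Adj (u 6) a ∧ a ≠ v) ∧ s(u 6, a) = e := by
    intro e
    simp [B, star]
  refine ⟨B, ?_, ?_, ?_⟩
  · intro e he
    rcases (mem_B e).1 he with ⟨a, h, rfl⟩ | ⟨a, ⟨h, -⟩, rfl⟩ | ⟨a, ⟨h, -⟩, rfl⟩ <;> exact h
  · have h0 := star_card (u 0) (G.neighborSet (u 0))
    have h2 := star_card (u 2) (G.neighborSet (u 2) \ {v})
    have h6 := star_card (u 6) (G.neighborSet (u 6) \ {v})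
    have e2 := Set.ncard_sdiff_singleton_add_one (s := G.neighborSet (u 2)) (hnbr 2).symm
    have e6 := Set.ncard_sdiff_singleton_add_one (s := G.neighborSet (u 6)) (hnbr 6).symm
    refine (Finset.card_union_le _ _).trans
      ((Nat.add_le_add_left (Finset.card_union_le _ _) _).trans ?_)
    lia
  · have hpendant : ∀ i : Fin 9, i = 2 ∨ i = 6 →
        ∀ a, (G.deleteEdges ↑B).Adj (u i) a ↔ a = v := by
      intro i hi a
      rw [SimpleGraph.deleteEdges_adj, Finset.mem_coe, mem_B]
      constructor
      · rintro ⟨ha, hB⟩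
        by_contra hav
        rcases hi with rfl | rfl
        exacts [hB (.inr (.inl ⟨a, ⟨ha, hav⟩, rfl⟩)), hB (.inr (.inr ⟨a, ⟨ha, hav⟩, rfl⟩))]
      · rintro rfl
        refine ⟨(hnbr i).symm, ?_⟩
        have := fun j => (hnbr j).ne
        have := hne i 0 (by rcases hi with rfl | rfl <;> decide)
        simp only [Sym2.eq_iff]
        grind
    refine SimpleGraph.indepDomNum_lt_of_pendant (v := v) (p := u 0) (q := u 2) (r := u 6)
      (t := u 4) (x := x) (hne _ _ (by decide)) (hne _ _ (by decide)) (hne _ _ (by decide))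
      (hne _ _ (by decide)) (hne _ _ (by decide)) (hne _ _ (by decide))
      (hnbr 0) (hnbr 2) (hnbr 6) (hnbr 4)
      (hind 0 (by decide) 2 (by decide)) (hind 0 (by decide) 6 (by decide))
      (hind 2 (by decide) 6 (by decide))
      (hclosed 0 1 8 (by decide) h01 hlast.symm hd1) (hclosed 2 1 3 (by decide) h12.symm h23 hd3)
      hx ?_ (G.deleteEdges_le _) ?_ (hpendant 2 (.inl rfl)) (hpendant 6 (.inr rfl)) ?_
    · intro w hw
      obtain ⟨i, rfl⟩ := hNv w hw
      fin_cases i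
      exacts [.inl (.inl rfl), .inr (.inl h01.symm), .inl (.inr (.inl rfl)),
        .inr (.inr (.inl h23.symm)), .inl (.inr (.inr (.inr rfl))), .inr (.inr (.inr h56)),
        .inl (.inr (.inr (.inl rfl))), .inr (.inr (.inr h67.symm)), .inr (.inl hlast)]
    · intro a ha
      rw [SimpleGraph.deleteEdges_adj, Finset.mem_coe, mem_B] at ha
      exact ha.2 (.inl ⟨a, ha.1, rfl⟩)
    · intro a b ha0 ha2 ha6 hb0 hb2 hb6 hab
      rw [SimpleGraph.deleteEdges_adj, Finset.mem_coe, mem_B]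
      refine ⟨hab, ?_⟩
      simp only [Sym2.eq_iff]
      grind
end
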